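/- Let Φ : ℂ → ℂ be entire, let r > 0, and let Γ ⊆ {z : |Φ(z)| = r} be a strictly convex compact arc with endpoints z₁, z₂ satisfying 0 < arg(z₁) < arg(z₂) < π and Re(z₁) ≠ Re(z₂). Suppose 0 ∉ conv(Γ) and that Ω := conv(Γ ∪ {0}) \ (Γ ∪ {0}) ⊆ {z : |Φ(z)| < r}. Let S(0,z₁,z₂) = {w ∈ ℂ : w ≠ 0 and arg(z₁) ≤ arg(w) ≤ arg(z₂)}. Then: (i) S(0,z₁,z₂) \ Γ has exactly two connected components, of which Ω is the bounded one; (ii) Ω = {t·z : t ∈ (0,1), z ∈ Γ} = {t·z : t ∈ (0,1), z ∈ conv(Γ)}; (iii) the topological boundary of Ω equals {t·z₁ : 0 ≤ t < 1} ∪ {t·z₂ : 0 < t < 1} ∪ Γ; (iv) writing I for the closed interval with endpoints Re(z₁) and Re(z₂), there is a function h : I → ℝ such that Γ ∩ (I × (0,∞)) = graph(h) ∪ {z₁, z₂} (identifying ℂ with ℝ²), and h is convex if Re(z₁) < Re(z₂) and concave if Re(z₂) < Re(z₁). -/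

import Mathlib

open Set

noncomputable section

/-- The region `Ω = conv(Γ ∪ {0}) \ (Γ ∪ {0})`. -/
def OmegaSet (Γ : Set ℂ) : Set ℂ := convexHull ℝ (Γ ∪ {0}) \ (Γ ∪ {0})

/-- The sector `S(0,z₁,z₂) = {w ≠ 0 : arg z₁ ≤ arg w ≤ arg z₂}` (for `0 < arg z₁ ≤ arg z₂ < π`
the principal argument agrees with the argument chosen in `[0, 2π)`). -/
def SectorSet (z₁ z₂ : ℂ) : Set ℂ :=
  {w : ℂ | w ≠ 0 ∧ z₁.arg ≤ w.arg ∧ w.arg ≤ z₂.arg}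

open scoped Topology

/-- The determinant of the pair `(z, w)` of vectors of `ℂ = ℝ²`. -/
def wedge (z w : ℂ) : ℝ := z.re * w.im - z.im * w.re

lemma continuous_wedge_left (w : ℂ) : Continuous fun z => wedge z w := by
  unfold wedge; fun_prop

lemma continuous_wedge_right (z : ℂ) : Continuous fun w => wedge z w := by
  unfold wedge; fun_prop

@[simp] lemma wedge_self (z : ℂ) : wedge z z = 0 := by unfold wedge; ring

@[simp] lemma wedge_mul_left (t : ℝ) (z w : ℂ) : wedge (t * z) w = t * wedge z w := by
  simp [wedge]; ring

@[simp] lemma wedge_mul_right (t : ℝ) (z w : ℂ) : wedge z (t * w) = t * wedge z w := by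
  simp [wedge]; ring

lemma wedge_smul_left (t : ℝ) (z w : ℂ) : wedge (t • z) w = t * wedge z w := by simp

lemma wedge_smul_right (t : ℝ) (z w : ℂ) : wedge z (t • w) = t * wedge z w := by simp

@[simp] lemma wedge_add_left (u v w : ℂ) : wedge (u + v) w = wedge u w + wedge v w := by
  simp [wedge]; ring

@[simp] lemma wedge_add_right (u v w : ℂ) : wedge u (v + w) = wedge u v + wedge u w := by
  simp [wedge]; ring

lemma wedge_swap (z w : ℂ) : wedge z w = -wedge w z := by unfold wedge; ring

lemma wedge_smul_eq (u v w : ℂ) : wedge u v • w = wedge w v • u + wedge u w • v := by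
  apply Complex.ext <;> simp [wedge] <;> ring

lemma exists_smul_eq_of_wedge_eq_zero {z w : ℂ} (hz : z ≠ 0) (h : wedge z w = 0) :
    ∃ c : ℝ, w = c • z := by
  have hn : z.re * z.re + z.im * z.im ≠ 0 := by
    have := Complex.normSq_pos.2 hz
    rw [Complex.normSq_apply] at this
    exact this.ne'
  unfold wedge at h
  refine ⟨(z.re * w.re + z.im * w.im) / (z.re * z.re + z.im * z.im), ?_⟩
  apply Complex.ext <;> rw [Complex.real_smul] <;>
    simp only [Complex.re_ofReal_mul, Complex.im_ofReal_mul] <;>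
    rw [div_mul_eq_mul_div, eq_div_iff hn]
  · linear_combination (-z.im) * h
  · linear_combination z.re * h

/-- The interior of a triangle with a vertex at the origin lies in the interior of every convex
set containing its vertices. -/
lemma mem_interior_of_wedge_pos {K : Set ℂ} (hK : Convex ℝ K) {p u w : ℂ} (h0 : 0 ∈ K)
    (hp : p ∈ K) (hu : u ∈ K) (h1 : 0 < wedge w u) (h2 : 0 < wedge p w)
    (h3 : wedge w u + wedge p w < wedge p u) : w ∈ interior K := by
  have ho : IsOpen {w | 0 < wedge w u ∧ 0 < wedge p w ∧ wedge w u + wedge p w < wedge p u} :=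
    (isOpen_lt continuous_const (continuous_wedge_left u)).inter
      ((isOpen_lt continuous_const (continuous_wedge_right p)).inter
        (isOpen_lt ((continuous_wedge_left u).add (continuous_wedge_right p)) continuous_const))
  refine interior_maximal ?_ ho ⟨h1, h2, h3⟩
  rintro v ⟨hv1, hv2, hv3⟩
  have hD : 0 < wedge p u := by linarith
  have hv : v = (wedge v u / wedge p u) • p + (wedge p v / wedge p u) • u := by
    rw [div_eq_inv_mul, div_eq_inv_mul, mul_smul, mul_smul, ← smul_add, ← wedge_smul_eq,
      inv_smul_smul₀ hD.ne']
  have hmem := (hK.starConvex h0).smul_mem (hK hp hu (a := wedge v u / (wedge v u + wedge p v))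
    (b := wedge p v / (wedge v u + wedge p v)) (by positivity) (by positivity) (by field_simp))
    (t := (wedge v u + wedge p v) / wedge p u) (by positivity) ((div_le_one hD).2 hv3.le)
  have hs : wedge v u + wedge p v ≠ 0 := by positivity
  rw [hv]
  convert hmem using 1
  rw [smul_add, smul_smul, smul_smul, div_mul_div_cancel₀' hs, div_mul_div_cancel₀' hs]

lemma notMem_interior_of_norm_lt {Φ : ℂ → ℂ} (hΦ : Differentiable ℂ Φ) {r : ℝ} {Γ K : Set ℂ}
    (hlev : ∀ z ∈ Γ, ‖Φ z‖ = r) (h0 : (0 : ℂ) ∉ Γ)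
    (hlt : ∀ z ∈ K \ (Γ ∪ {0}), ‖Φ z‖ < r) (hne : (K \ (Γ ∪ {0})).Nonempty) {z : ℂ}
    (hz : z ∈ Γ) : z ∉ interior K := by
  intro hzK
  have hz0 : z ≠ 0 := fun h => h0 (h ▸ hz)
  have hmax : IsLocalMax (norm ∘ Φ) z := by
    filter_upwards [mem_interior_iff_mem_nhds.1 hzK, isOpen_ne.mem_nhds hz0] with y hy hy0
    by_cases hyΓ : y ∈ Γ
    · simp [hlev y hyΓ, hlev z hz]
    · simpa [hlev z hz] using (hlt y ⟨hy, by simp_all⟩).le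
  have hev := Complex.eventually_eq_of_isLocalMax_norm (.of_forall fun y => hΦ y) hmax
  have heq : Φ = fun _ => Φ z :=
    AnalyticOnNhd.eq_of_eventuallyEq (fun y _ => hΦ.analyticAt y) (fun y _ => analyticAt_const)
      hev
  obtain ⟨y, hy⟩ := hne
  have := hlt y hy
  rw [heq, hlev z hz] at this
  exact lt_irrefl _ this

/-- No line contains three distinct points of `Γ`. -/
def StrictlyConvexArc (Γ : Set ℂ) : Prop :=
  ∀ u ∈ Γ, ∀ v ∈ Γ, ∀ w ∈ Γ, Collinear ℝ {u, v, w} → u = v ∨ u = w ∨ v = w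

lemma strictlyConvexArc_of_segment {Γ : Set ℂ}
    (h : ∀ w₁ ∈ Γ, ∀ w₂ ∈ Γ, ∀ u ∈ segment ℝ w₁ w₂ ∩ Γ, ∀ v ∈ segment ℝ w₁ w₂ ∩ Γ,
      ∀ w ∈ segment ℝ w₁ w₂ ∩ Γ, u = v ∨ u = w ∨ v = w) : StrictlyConvexArc Γ := by
  intro u hu v hv w hw hc
  rcases hc.wbtw_or_wbtw_or_wbtw with hb | hb | hb <;> rw [← mem_segment_iff_wbtw] at hb
  · exact h u hu w hw u ⟨left_mem_segment _ _ _, hu⟩ v ⟨hb, hv⟩ w ⟨right_mem_segment _ _ _, hw⟩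
  · exact h v hv u hu u ⟨right_mem_segment _ _ _, hu⟩ v ⟨left_mem_segment _ _ _, hv⟩ w ⟨hb, hw⟩
  · exact h w hw v hv u ⟨hb, hu⟩ v ⟨right_mem_segment _ _ _, hv⟩ w ⟨left_mem_segment _ _ _, hw⟩

lemma collinear_of_eq_add_smul {p e u v w : ℂ} (hu : ∃ c : ℝ, u = p + c • e)
    (hv : ∃ c : ℝ, v = p + c • e) (hw : ∃ c : ℝ, w = p + c • e) : Collinear ℝ {u, v, w} := by
  rw [collinear_iff_exists_forall_eq_smul_vadd]
  refine ⟨p, e, ?_⟩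
  simp only [mem_insert_iff, mem_singleton_iff, forall_eq_or_imp, forall_eq, vadd_eq_add]
  simp only [add_comm p] at hu hv hw
  exact ⟨hu, hv, hw⟩

lemma frequently_mem_image_of_injOn {γ : ℝ → ℂ} (hc : ContinuousOn γ (Icc 0 1))
    (hi : InjOn γ (Icc 0 1)) {q : ℂ} (hq : q ∈ γ '' Icc 0 1) :
    ∃ᶠ z in 𝓝 q, z ≠ q ∧ z ∈ γ '' Icc 0 1 := by
  obtain ⟨s, hs, rfl⟩ := hq
  have hacc : AccPt s (Filter.principal (Icc (0 : ℝ) 1)) :=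
    (isPreconnected_Icc.preperfect_of_nontrivial ⟨0, by simp, 1, by simp, by simp⟩) s hs
  rw [accPt_iff_frequently] at hacc
  rw [Filter.frequently_iff]
  intro V hV
  have hev : ∀ᶠ t in 𝓝 s, t ∈ Icc (0 : ℝ) 1 → γ t ∈ V :=
    eventually_nhdsWithin_iff.1 ((hc s hs).eventually hV)
  obtain ⟨t, ⟨hts, ht⟩, htV⟩ := (hacc.and_eventually hev).exists
  exact ⟨γ t, htV ht, fun h => hts (hi ht hs h), t, ht, rfl⟩

lemma frequently_wedge_ne_zero {Γ : Set ℂ} (hconv : StrictlyConvexArc Γ) {p q : ℂ}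
    (hp : p ≠ 0) (hq : q ∈ Γ) (hpq : wedge p q = 0) (hacc : ∃ᶠ z in 𝓝 q, z ≠ q ∧ z ∈ Γ) :
    ∃ᶠ z in 𝓝 q, z ∈ Γ ∧ wedge p z ≠ 0 := by
  have key : ∃ q', q' ≠ q ∧ ∀ z ∈ Γ, wedge p z = 0 → z ≠ q → z = q' := by
    by_cases h : ∃ q' ∈ Γ, wedge p q' = 0 ∧ q' ≠ q
    · obtain ⟨q', hq', hpq', hne⟩ := h
      refine ⟨q', hne, fun z hz hpz hzq => ?_⟩
      have hcol : ∀ {x}, wedge p x = 0 → ∃ c : ℝ, x = 0 + c • p := fun hx => by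
        simpa using exists_smul_eq_of_wedge_eq_zero hp hx
      rcases hconv z hz q hq q' hq'
        (collinear_of_eq_add_smul (hcol hpz) (hcol hpq) (hcol hpq')) with h | h | h
      · exact absurd h hzq
      · exact h
      · exact absurd h.symm hne
    · push Not at h
      exact ⟨q + 1, by simp, fun z hz hpz hzq => absurd (h z hz hpz) hzq⟩
  obtain ⟨q', hne, hq'⟩ := key
  refine (hacc.and_eventually (isOpen_ne.mem_nhds hne.symm)).mono ?_
  rintro z ⟨⟨hzq, hz⟩, hzq'⟩
  exact ⟨hz, fun h => hzq' (hq' z hz h hzq)⟩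

/-- If the arc does not meet the interior of the convex set `K ⊇ Γ ∪ {0}`, then no point of `K`
lies strictly behind a point of the arc, seen from the origin. -/
lemma smul_notMem_of_notMem_interior {Γ K : Set ℂ} (hK : Convex ℝ K) (hΓK : Γ ⊆ K)
    (h0K : (0 : ℂ) ∈ K) (h0 : (0 : ℂ) ∉ Γ) (hconv : StrictlyConvexArc Γ)
    (hacc : ∀ q ∈ Γ, ∃ᶠ z in 𝓝 q, z ≠ q ∧ z ∈ Γ) (hint : ∀ z ∈ Γ, z ∉ interior K)
    {p : ℂ} (hp : p ∈ K) {s : ℝ} (hs0 : 0 < s) (hs1 : s < 1) : s • p ∉ Γ := by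
  intro hq
  have hp0 : p ≠ 0 := by
    rintro rfl
    exact h0 (by simpa using hq)
  have hfr := frequently_wedge_ne_zero hconv hp0 hq (by simp) (hacc _ hq)
  have hfr' : ∃ᶠ z in 𝓝 (s • p), (z ∈ Γ ∧ 0 < wedge p z) ∨ (z ∈ Γ ∧ 0 < wedge z p) := by
    refine hfr.mono fun z hz => ?_
    rcases lt_or_gt_of_ne hz.2 with h | h
    · exact .inr ⟨hz.1, by rw [wedge_swap]; linarith⟩
    · exact .inl ⟨hz.1, h⟩
  rcases Filter.frequently_or_distrib.1 hfr' with h | h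
  · obtain ⟨u, hu, hpu⟩ := h.exists
    have e1 : ∀ᶠ z in 𝓝 (s • p), 0 < wedge z u :=
      (continuous_wedge_left u).continuousAt.eventually (lt_mem_nhds (by simp; positivity))
    have e2 : ∀ᶠ z in 𝓝 (s • p), wedge z u + wedge p z < wedge p u :=
      ((continuous_wedge_left u).add (continuous_wedge_right p)).continuousAt.eventually
        (gt_mem_nhds (by simp; nlinarith))
    obtain ⟨z, ⟨hz, hz1⟩, hz2, hz3⟩ := (h.and_eventually (e1.and e2)).exists
    exact hint z hz (mem_interior_of_wedge_pos hK h0K hp (hΓK hu) hz2 hz1 hz3)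
  · obtain ⟨u, hu, hpu⟩ := h.exists
    have e1 : ∀ᶠ z in 𝓝 (s • p), 0 < wedge u z :=
      (continuous_wedge_right u).continuousAt.eventually (lt_mem_nhds (by simp; positivity))
    have e2 : ∀ᶠ z in 𝓝 (s • p), wedge z p + wedge u z < wedge u p :=
      ((continuous_wedge_left p).add (continuous_wedge_right u)).continuousAt.eventually
        (gt_mem_nhds (by simp; nlinarith))
    obtain ⟨z, ⟨hz, hz1⟩, hz2, hz3⟩ := (h.and_eventually (e1.and e2)).exists
    exact hint z hz (mem_interior_of_wedge_pos hK h0K (hΓK hu) hp hz1 hz2 hz3)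

/-- A compact connected set meeting each ray of the closed sector spanned by `z₁` and `z₂` in
exactly one point, with endpoints `z₁` and `z₂`. -/
structure IsRadialArc (Γ : Set ℂ) (z₁ z₂ : ℂ) : Prop where
  isCompact : IsCompact Γ
  isPreconnected : IsPreconnected Γ
  left_mem : z₁ ∈ Γ
  right_mem : z₂ ∈ Γ
  zero_notMem : (0 : ℂ) ∉ Γ
  wedge_pos : 0 < wedge z₁ z₂
  left_nonneg : ∀ z ∈ Γ, 0 ≤ wedge z₁ z
  right_nonneg : ∀ z ∈ Γ, 0 ≤ wedge z z₂
  exists_smul : ∀ w ≠ 0, 0 ≤ wedge z₁ w → 0 ≤ wedge w z₂ → ∃ t > (0 : ℝ), ∃ z ∈ Γ, w = t • z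
  eq_one : ∀ z ∈ Γ, ∀ t > (0 : ℝ), t • z ∈ Γ → t = 1

lemma isRadialArc_of_path {γ : ℝ → ℂ} {K : Set ℂ} (hc : ContinuousOn γ (Icc 0 1))
    (hi : InjOn γ (Icc 0 1)) (hpos : 0 < wedge (γ 0) (γ 1))
    (h0 : (0 : ℂ) ∉ convexHull ℝ (γ '' Icc 0 1)) (hΓK : γ '' Icc 0 1 ⊆ K)
    (hray : ∀ p ∈ K, ∀ s : ℝ, 0 < s → s < 1 → s • p ∉ γ '' Icc 0 1) :
    IsRadialArc (γ '' Icc 0 1) (γ 0) (γ 1) := by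
  have h0Γ : (0 : ℂ) ∉ γ '' Icc 0 1 := fun h => h0 (subset_convexHull ℝ _ h)
  have mem0 : (0 : ℝ) ∈ Icc (0 : ℝ) 1 := by simp
  have mem1 : (1 : ℝ) ∈ Icc (0 : ℝ) 1 := by simp
  have eq_one : ∀ z ∈ γ '' Icc 0 1, ∀ t > (0 : ℝ), t • z ∈ γ '' Icc 0 1 → t = 1 := by
    intro z hz t ht htz
    rcases lt_trichotomy t 1 with h | h | h
    · exact absurd htz (hray z (hΓK hz) t ht h)
    · exact h
    · refine absurd hz ?_
      have := hray _ (hΓK htz) t⁻¹ (by positivity) (inv_lt_one_of_one_lt₀ h)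
      rwa [inv_smul_smul₀ ht.ne'] at this
  have hne : ∀ s ∈ Icc (0 : ℝ) 1, ∀ t ∈ Icc (0 : ℝ) 1, wedge (γ s) (γ t) = 0 → s = t := by
    intro s hs t ht hst
    have hsΓ := mem_image_of_mem γ hs
    have htΓ := mem_image_of_mem γ ht
    obtain ⟨c, hc'⟩ := exists_smul_eq_of_wedge_eq_zero (fun h => h0Γ (h ▸ hsΓ)) hst
    rcases lt_trichotomy c 0 with h | h | h
    · refine absurd ?_ h0
      have h1 : 0 < 1 - c := by linarith
      have := (convex_convexHull ℝ (γ '' Icc 0 1)) (subset_convexHull ℝ _ hsΓ)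
        (subset_convexHull ℝ _ htΓ) (a := -c / (1 - c)) (b := 1 / (1 - c))
        (div_nonneg (by linarith) h1.le) (by positivity) (by field_simp; ring)
      convert this using 1
      rw [hc', smul_smul, ← add_smul]
      have : -c / (1 - c) + 1 / (1 - c) * c = 0 := by field_simp; ring
      rw [this, zero_smul]
    · rw [h, zero_smul] at hc'
      exact absurd (hc' ▸ htΓ) h0Γ
    · have := eq_one _ hsΓ c h (hc' ▸ htΓ)
      rw [this, one_smul] at hc'
      exact hi hs ht hc'.symm
  have hpos' : ∀ s ∈ Icc (0 : ℝ) 1, ∀ t ∈ Icc (0 : ℝ) 1, s < t → 0 < wedge (γ s) (γ t) := by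
    intro s hs t ht hst
    by_contra hle
    have hconv : Convex ℝ {x : ℝ × ℝ | 0 ≤ x.1 ∧ x.1 < x.2 ∧ x.2 ≤ 1} := by
      rintro ⟨a, b⟩ ⟨h1, h2, h3⟩ ⟨a', b'⟩ ⟨h1', h2', h3'⟩ u v hu hv huv
      simp only [mem_ofPred_eq, Prod.smul_mk, Prod.mk_add_mk, smul_eq_mul] at *
      refine ⟨by positivity, ?_, by nlinarith⟩
      rcases hu.eq_or_lt with rfl | hu
      · have : v = 1 := by linarith
        subst this
        linarith
      · nlinarith [mul_lt_mul_of_pos_left h2 hu, mul_le_mul_of_nonneg_left h2'.le hv]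
    have hcont : ContinuousOn (fun x : ℝ × ℝ => wedge (γ x.1) (γ x.2))
        {x : ℝ × ℝ | 0 ≤ x.1 ∧ x.1 < x.2 ∧ x.2 ≤ 1} := by
      have h1 : ContinuousOn (fun x : ℝ × ℝ => γ x.1)
          {x : ℝ × ℝ | 0 ≤ x.1 ∧ x.1 < x.2 ∧ x.2 ≤ 1} :=
        hc.comp continuousOn_fst fun x hx => ⟨hx.1, by linarith [hx.2.1, hx.2.2]⟩
      have h2 : ContinuousOn (fun x : ℝ × ℝ => γ x.2)
          {x : ℝ × ℝ | 0 ≤ x.1 ∧ x.1 < x.2 ∧ x.2 ≤ 1} :=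
        hc.comp continuousOn_snd fun x hx => ⟨by linarith [hx.1, hx.2.1], hx.2.2⟩
      unfold wedge
      exact ((Complex.continuous_re.comp_continuousOn h1).mul
        (Complex.continuous_im.comp_continuousOn h2)).sub
        ((Complex.continuous_im.comp_continuousOn h1).mul
        (Complex.continuous_re.comp_continuousOn h2))
    obtain ⟨⟨a, b⟩, ⟨ha, hab, hb⟩, h⟩ := hconv.isPreconnected.intermediate_value
      (a := (s, t)) (b := (0, 1)) ⟨hs.1, hst, ht.2⟩ ⟨le_rfl, zero_lt_one, le_rfl⟩ hcont
      ⟨not_lt.1 hle, hpos.le⟩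
    exact hab.ne (hne a ⟨ha, hab.le.trans hb⟩ b ⟨ha.trans hab.le, hb⟩ h)
  have left_nonneg : ∀ z ∈ γ '' Icc 0 1, 0 ≤ wedge (γ 0) z := by
    rintro _ ⟨t, ht, rfl⟩
    rcases ht.1.eq_or_lt with rfl | h
    · simp
    · exact (hpos' 0 mem0 t ht h).le
  have right_nonneg : ∀ z ∈ γ '' Icc 0 1, 0 ≤ wedge z (γ 1) := by
    rintro _ ⟨t, ht, rfl⟩
    rcases ht.2.eq_or_lt with rfl | h
    · simp
    · exact (hpos' t ht 1 mem1 h).le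
  refine ⟨isCompact_Icc.image_of_continuousOn hc, isPreconnected_Icc.image _ hc,
    mem_image_of_mem γ mem0, mem_image_of_mem γ mem1, h0Γ, hpos, left_nonneg, right_nonneg, ?_,
    eq_one⟩
  intro w hw h1 h2
  have hcont : ContinuousOn (fun s => wedge w (γ s)) (Icc 0 1) :=
    (continuous_wedge_right w).comp_continuousOn hc
  obtain ⟨s, hs, hws⟩ := isPreconnected_Icc.intermediate_value mem0 mem1 hcont
    (show (0 : ℝ) ∈ Icc _ _ from ⟨by rw [wedge_swap]; linarith, h2⟩)
  have hsΓ := mem_image_of_mem γ hs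
  obtain ⟨c, rfl⟩ := exists_smul_eq_of_wedge_eq_zero (z := γ s) (w := w)
    (fun h => h0Γ (h ▸ hsΓ)) (by rw [wedge_swap]; exact neg_eq_zero.2 hws)
  rw [wedge_smul_left] at h2
  rw [wedge_smul_right] at h1
  refine ⟨c, ?_, _, hsΓ, rfl⟩
  by_contra hc0
  have hc0 : c < 0 := lt_of_le_of_ne (not_lt.1 hc0) (by rintro rfl; simp at hw)
  have e1 : wedge (γ 0) (γ s) = 0 := by nlinarith [left_nonneg _ hsΓ]
  have e2 : wedge (γ s) (γ 1) = 0 := by nlinarith [right_nonneg _ hsΓ]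
  have := hne 0 mem0 s hs e1
  have := hne s hs 1 mem1 e2
  linarith

namespace IsRadialArc

variable {Γ : Set ℂ} {z₁ z₂ : ℂ} (h : IsRadialArc Γ z₁ z₂)
include h

lemma eq_left {z : ℂ} (hz : z ∈ Γ) (hw : wedge z₁ z = 0) : z = z₁ := by
  obtain ⟨c, rfl⟩ := exists_smul_eq_of_wedge_eq_zero
    (fun h' => h.zero_notMem (h' ▸ h.left_mem)) hw
  have h1 := h.right_nonneg _ hz
  rw [wedge_smul_left] at h1
  have hc : 0 < c := lt_of_le_of_ne (nonneg_of_mul_nonneg_left h1 h.wedge_pos)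
    (by rintro rfl; exact h.zero_notMem (by simpa using hz))
  rw [h.eq_one _ h.left_mem c hc hz, one_smul]

lemma eq_right {z : ℂ} (hz : z ∈ Γ) (hw : wedge z z₂ = 0) : z = z₂ := by
  obtain ⟨c, rfl⟩ := exists_smul_eq_of_wedge_eq_zero (z := z₂) (w := z)
    (fun h' => h.zero_notMem (h' ▸ h.right_mem)) (by rw [wedge_swap, hw, neg_zero])
  have h1 := h.left_nonneg _ hz
  rw [wedge_smul_right] at h1
  have hc : 0 < c := lt_of_le_of_ne (nonneg_of_mul_nonneg_left h1 h.wedge_pos)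
    (by rintro rfl; exact h.zero_notMem (by simpa using hz))
  rw [h.eq_one _ h.right_mem c hc hz, one_smul]

lemma mul_eq_one {z : ℂ} (hz : z ∈ Γ) {s t : ℝ} (hs : 0 ≤ s) (ht : 0 < t)
    (hst : s • t • z ∈ Γ) : s * t = 1 := by
  rw [smul_smul] at hst
  refine h.eq_one z hz _ (mul_pos (lt_of_le_of_ne hs ?_) ht) hst
  rintro rfl
  exact h.zero_notMem (by simpa using hst)

end IsRadialArc

/-- The points between the origin and `Γ`. -/
def innerCone (Γ : Set ℂ) : Set ℂ := (fun x : ℝ × ℂ => x.1 • x.2) '' Ioo 0 1 ×ˢ Γ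

/-- The points behind `Γ`, seen from the origin. -/
def outerCone (Γ : Set ℂ) : Set ℂ := (fun x : ℝ × ℂ => x.1 • x.2) '' Ioi 1 ×ˢ Γ

/-- The union of the segments from the origin to `Γ`. -/
def closedCone (Γ : Set ℂ) : Set ℂ := (fun x : ℝ × ℂ => x.1 • x.2) '' Icc 0 1 ×ˢ Γ

/-- The points from which a homothety of ratio at most `1` leads to `Γ`. -/
def shadow (Γ : Set ℂ) : Set ℂ := {w | ∃ s ∈ Icc (0 : ℝ) 1, s • w ∈ Γ}

/-- The closed sector spanned by `z₁` and `z₂`, without the origin. -/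
def wedgeSector (z₁ z₂ : ℂ) : Set ℂ := {w | w ≠ 0 ∧ 0 ≤ wedge z₁ w ∧ 0 ≤ wedge w z₂}

lemma smul_mem_innerCone {Γ : Set ℂ} {t : ℝ} {z : ℂ} (h0 : 0 < t) (h1 : t < 1) (hz : z ∈ Γ) :
    t • z ∈ innerCone Γ := ⟨(t, z), ⟨⟨h0, h1⟩, hz⟩, rfl⟩

lemma smul_mem_outerCone {Γ : Set ℂ} {t : ℝ} {z : ℂ} (h1 : 1 < t) (hz : z ∈ Γ) :
    t • z ∈ outerCone Γ := ⟨(t, z), ⟨h1, hz⟩, rfl⟩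

lemma smul_mem_closedCone {Γ : Set ℂ} {t : ℝ} {z : ℂ} (h0 : 0 ≤ t) (h1 : t ≤ 1) (hz : z ∈ Γ) :
    t • z ∈ closedCone Γ := ⟨(t, z), ⟨⟨h0, h1⟩, hz⟩, rfl⟩

lemma innerCone_subset_closedCone (Γ : Set ℂ) : innerCone Γ ⊆ closedCone Γ :=
  image_mono (prod_mono Ioo_subset_Icc_self subset_rfl)

lemma subset_closedCone (Γ : Set ℂ) : Γ ⊆ closedCone Γ := fun z hz => by
  simpa using smul_mem_closedCone (t := 1) zero_le_one le_rfl hz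

lemma isClosed_shadow {Γ : Set ℂ} (hΓ : IsClosed Γ) : IsClosed (shadow Γ) := by
  have : shadow Γ = Prod.snd '' {x : Icc (0 : ℝ) 1 × ℂ | (x.1 : ℝ) • x.2 ∈ Γ} := by
    ext w
    constructor
    · rintro ⟨s, hs, hw⟩
      exact ⟨(⟨s, hs⟩, w), hw, rfl⟩
    · rintro ⟨⟨s, w⟩, hw, rfl⟩
      exact ⟨s, s.2, hw⟩
  rw [this]
  exact isClosedMap_snd_of_compactSpace _ (hΓ.preimage (by fun_prop))

namespace IsRadialArc

variable {Γ : Set ℂ} {z₁ z₂ : ℂ} (h : IsRadialArc Γ z₁ z₂)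
include h

lemma isCompact_closedCone : IsCompact (closedCone Γ) :=
  (isCompact_Icc.prod h.isCompact).image (by fun_prop)

lemma smul_mem_wedgeSector {t : ℝ} {z : ℂ} (ht : 0 < t) (hz : z ∈ Γ) :
    t • z ∈ wedgeSector z₁ z₂ := by
  refine ⟨smul_ne_zero ht.ne' fun h' => h.zero_notMem (h' ▸ hz), ?_, ?_⟩
  · rw [wedge_smul_right]
    exact mul_nonneg ht.le (h.left_nonneg z hz)
  · rw [wedge_smul_left]
    exact mul_nonneg ht.le (h.right_nonneg z hz)

lemma wedgeSector_diff_eq : wedgeSector z₁ z₂ \ Γ = innerCone Γ ∪ outerCone Γ := by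
  apply subset_antisymm
  · rintro w ⟨⟨hw0, hw1, hw2⟩, hwΓ⟩
    obtain ⟨t, ht, z, hz, rfl⟩ := h.exists_smul w hw0 hw1 hw2
    rcases lt_trichotomy t 1 with h1 | rfl | h1
    · exact .inl (smul_mem_innerCone ht h1 hz)
    · exact absurd hz (by simpa using hwΓ)
    · exact .inr (smul_mem_outerCone h1 hz)
  · rintro _ (⟨⟨t, z⟩, ⟨⟨ht0, ht1⟩, hz⟩, rfl⟩ | ⟨⟨t, z⟩, ⟨ht1, hz⟩, rfl⟩)
    · exact ⟨h.smul_mem_wedgeSector ht0 hz, fun h' => ht1.ne (h.eq_one z hz t ht0 h')⟩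
    · have ht1 : 1 < t := ht1
      have ht0 : 0 < t := by linarith
      exact ⟨h.smul_mem_wedgeSector ht0 hz, fun h' => ht1.ne' (h.eq_one z hz t ht0 h')⟩

lemma disjoint_innerCone_shadow : Disjoint (innerCone Γ) (shadow Γ) := by
  rw [Set.disjoint_left]
  rintro _ ⟨⟨t, z⟩, ⟨⟨ht0, ht1⟩, hz⟩, rfl⟩ ⟨s, ⟨hs0, hs1⟩, hs⟩
  have ht0 : 0 < t := ht0
  have ht1 : t < 1 := ht1
  nlinarith [h.mul_eq_one hz hs0 ht0 hs]

omit h in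
lemma outerCone_subset_shadow : outerCone Γ ⊆ shadow Γ := by
  rintro _ ⟨⟨t, z⟩, ⟨ht1, hz⟩, rfl⟩
  have ht1 : 1 < t := ht1
  have ht0 : 0 < t := by linarith
  exact ⟨t⁻¹, ⟨by positivity, (inv_lt_one_of_one_lt₀ ht1).le⟩,
    by simpa only [inv_smul_smul₀ ht0.ne'] using hz⟩

lemma disjoint_outerCone_closedCone : Disjoint (outerCone Γ) (closedCone Γ) := by
  rw [Set.disjoint_left]
  rintro _ ⟨⟨t, z⟩, ⟨ht1, hz⟩, rfl⟩ ⟨⟨s, z'⟩, ⟨⟨hs0, hs1⟩, hz'⟩, hs⟩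
  have ht1 : 1 < t := ht1
  have ht0 : 0 < t := by linarith
  have hs0 : 0 ≤ s := hs0
  have hs1 : s ≤ 1 := hs1
  have hs : s • z' = t • z := hs
  have hzz : (t⁻¹ * s) • z' = z := by rw [mul_smul, hs, inv_smul_smul₀ ht0.ne']
  have h1 := h.eq_one z' hz' (t⁻¹ * s) (lt_of_le_of_ne (by positivity) fun h' =>
    h.zero_notMem (by rw [← h', zero_smul] at hzz; exact hzz ▸ hz)) (hzz.symm ▸ hz)
  field_simp at h1
  linarith

omit h in
lemma isPreconnected_innerCone (hΓ : IsPreconnected Γ) : IsPreconnected (innerCone Γ) :=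
  (isPreconnected_Ioo.prod hΓ).image _ (by fun_prop)

omit h in
lemma isPreconnected_outerCone (hΓ : IsPreconnected Γ) : IsPreconnected (outerCone Γ) :=
  (isPreconnected_Ioi.prod hΓ).image _ (by fun_prop)

lemma subset_or_subset_of_isPreconnected {C : Set ℂ} (hC : IsPreconnected C)
    (hCs : C ⊆ wedgeSector z₁ z₂ \ Γ) : C ⊆ innerCone Γ ∨ C ⊆ outerCone Γ := by
  rw [h.wedgeSector_diff_eq] at hCs
  have h1 := isPreconnected_iff_subset_of_disjoint_closed.1 hC (closedCone Γ) (shadow Γ)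
    h.isCompact_closedCone.isClosed (isClosed_shadow h.isCompact.isClosed)
    (hCs.trans (union_subset_union (innerCone_subset_closedCone Γ) outerCone_subset_shadow))
    (by
      rw [← disjoint_iff_inter_eq_empty, Set.disjoint_left]
      rintro w hw ⟨hw1, hw2⟩
      rcases hCs hw with hw | hw
      · exact h.disjoint_innerCone_shadow.le_bot ⟨hw, hw2⟩
      · exact h.disjoint_outerCone_closedCone.le_bot ⟨hw, hw1⟩)
  refine h1.imp (fun hs w hw => ?_) fun hs w hw => ?_
  · exact (hCs hw).resolve_right fun hw' => h.disjoint_outerCone_closedCone.le_bot ⟨hw', hs hw⟩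
  · exact (hCs hw).resolve_left fun hw' => h.disjoint_innerCone_shadow.le_bot ⟨hw', hs hw⟩

lemma disjoint_innerCone_outerCone : Disjoint (innerCone Γ) (outerCone Γ) :=
  h.disjoint_innerCone_shadow.mono_right outerCone_subset_shadow

lemma connectedComponentIn_eq_innerCone {w : ℂ} (hw : w ∈ innerCone Γ) :
    connectedComponentIn (wedgeSector z₁ z₂ \ Γ) w = innerCone Γ := by
  have hsub : innerCone Γ ⊆ wedgeSector z₁ z₂ \ Γ := by
    rw [h.wedgeSector_diff_eq]; exact subset_union_left
  have hmem := mem_connectedComponentIn (hsub hw)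
  refine subset_antisymm ?_
    ((isPreconnected_innerCone h.isPreconnected).subset_connectedComponentIn hw hsub)
  exact (h.subset_or_subset_of_isPreconnected isPreconnected_connectedComponentIn
    (connectedComponentIn_subset _ _)).resolve_right fun h' =>
      h.disjoint_innerCone_outerCone.le_bot ⟨hw, h' hmem⟩

lemma connectedComponentIn_eq_outerCone {w : ℂ} (hw : w ∈ outerCone Γ) :
    connectedComponentIn (wedgeSector z₁ z₂ \ Γ) w = outerCone Γ := by
  have hsub : outerCone Γ ⊆ wedgeSector z₁ z₂ \ Γ := by
    rw [h.wedgeSector_diff_eq]; exact subset_union_right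
  have hmem := mem_connectedComponentIn (hsub hw)
  refine subset_antisymm ?_
    ((isPreconnected_outerCone h.isPreconnected).subset_connectedComponentIn hw hsub)
  exact (h.subset_or_subset_of_isPreconnected isPreconnected_connectedComponentIn
    (connectedComponentIn_subset _ _)).resolve_left fun h' =>
      h.disjoint_innerCone_outerCone.le_bot ⟨h' hmem, hw⟩

lemma half_smul_mem_innerCone : (1 / 2 : ℝ) • z₁ ∈ innerCone Γ :=
  smul_mem_innerCone (by norm_num) (by norm_num) h.left_mem

lemma two_smul_mem_outerCone : (2 : ℝ) • z₁ ∈ outerCone Γ :=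
  smul_mem_outerCone (by norm_num) h.left_mem

lemma isBounded_innerCone : Bornology.IsBounded (innerCone Γ) :=
  h.isCompact_closedCone.isBounded.subset (innerCone_subset_closedCone Γ)

lemma not_isBounded_outerCone : ¬ Bornology.IsBounded (outerCone Γ) := by
  intro hb
  obtain ⟨C, hC⟩ := hb.exists_norm_le
  have hz : 0 < ‖z₁‖ := norm_pos_iff.2 fun h' => h.zero_notMem (h' ▸ h.left_mem)
  have h1 := hC _ (smul_mem_outerCone (t := 2 + |C| / ‖z₁‖)
    (by linarith [show 0 ≤ |C| / ‖z₁‖ by positivity]) h.left_mem)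
  rw [norm_smul, Real.norm_of_nonneg (by positivity), add_mul, div_mul_cancel₀ _ hz.ne'] at h1
  linarith [le_abs_self C]

lemma exists_components :
    ∃ U : Set ℂ,
      (∀ w ∈ wedgeSector z₁ z₂ \ Γ,
        connectedComponentIn (wedgeSector z₁ z₂ \ Γ) w = innerCone Γ ∨
        connectedComponentIn (wedgeSector z₁ z₂ \ Γ) w = U) ∧
      U ≠ innerCone Γ ∧
      (∃ w ∈ wedgeSector z₁ z₂ \ Γ,
        connectedComponentIn (wedgeSector z₁ z₂ \ Γ) w = innerCone Γ) ∧
      (∃ w ∈ wedgeSector z₁ z₂ \ Γ, connectedComponentIn (wedgeSector z₁ z₂ \ Γ) w = U) ∧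
      Bornology.IsBounded (innerCone Γ) ∧ ¬ Bornology.IsBounded U := by
  refine ⟨outerCone Γ, fun w hw => ?_, fun h' => ?_,
    ⟨_, ?_, h.connectedComponentIn_eq_innerCone h.half_smul_mem_innerCone⟩,
    ⟨_, ?_, h.connectedComponentIn_eq_outerCone h.two_smul_mem_outerCone⟩,
    h.isBounded_innerCone, h.not_isBounded_outerCone⟩
  · rw [h.wedgeSector_diff_eq] at hw
    exact hw.imp h.connectedComponentIn_eq_innerCone h.connectedComponentIn_eq_outerCone
  · exact h.not_isBounded_outerCone (h' ▸ h.isBounded_innerCone)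
  · rw [h.wedgeSector_diff_eq]
    exact .inl h.half_smul_mem_innerCone
  · rw [h.wedgeSector_diff_eq]
    exact .inr h.two_smul_mem_outerCone

lemma interior_innerCone :
    interior (innerCone Γ) = {w | 0 < wedge z₁ w ∧ 0 < wedge w z₂ ∧ w ∉ shadow Γ} := by
  apply subset_antisymm
  · intro w hw
    have hwi := interior_subset hw
    have hsec : ∀ v ∈ innerCone Γ, v ∈ wedgeSector z₁ z₂ := fun v hv =>
      (h.wedgeSector_diff_eq.symm ▸ .inl hv : v ∈ wedgeSector z₁ z₂ \ Γ).1
    have hpush : ∀ u : ℂ, ∃ t > (0 : ℝ), w - t • u ∈ innerCone Γ := fun u => by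
      have hc : ContinuousAt (fun t : ℝ => w - t • u) 0 := by fun_prop
      have hev : ∀ᶠ t in 𝓝 (0 : ℝ), w - t • u ∈ innerCone Γ :=
        hc.eventually (by simpa using mem_interior_iff_mem_nhds.1 hw)
      obtain ⟨t, ht, ht0⟩ :=
        ((hev.filter_mono nhdsWithin_le_nhds).and (self_mem_nhdsWithin (s := Ioi (0 : ℝ)))).exists
      exact ⟨t, ht0, ht⟩
    refine ⟨?_, ?_, fun h' => h.disjoint_innerCone_shadow.le_bot ⟨hwi, h'⟩⟩
    · obtain ⟨t, ht, hmem⟩ := hpush z₂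
      have := (hsec _ hmem).2.1
      rw [sub_eq_add_neg, ← neg_smul, wedge_add_right, wedge_smul_right] at this
      nlinarith [h.wedge_pos]
    · obtain ⟨t, ht, hmem⟩ := hpush z₁
      have := (hsec _ hmem).2.2
      rw [sub_eq_add_neg, ← neg_smul, wedge_add_left, wedge_smul_left] at this
      nlinarith [h.wedge_pos]
  · refine interior_maximal ?_ ((isOpen_lt continuous_const (continuous_wedge_right z₁)).inter
      ((isOpen_lt continuous_const (continuous_wedge_left z₂)).inter
        (isClosed_shadow h.isCompact.isClosed).isOpen_compl))
    rintro w ⟨h1, h2, h3⟩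
    obtain ⟨t, ht, z, hz, rfl⟩ := h.exists_smul w (by rintro rfl; simp [wedge] at h1) h1.le h2.le
    refine smul_mem_innerCone ht ?_ hz
    by_contra! hle
    exact h3 ⟨t⁻¹, ⟨by positivity, inv_le_one_of_one_le₀ hle⟩, by rwa [inv_smul_smul₀ ht.ne']⟩

lemma smul_mem_interior_innerCone {t : ℝ} {z : ℂ} (ht0 : 0 < t) (ht1 : t < 1) (hz : z ∈ Γ)
    (h1 : z ≠ z₁) (h2 : z ≠ z₂) : t • z ∈ interior (innerCone Γ) := by
  rw [h.interior_innerCone]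
  refine ⟨?_, ?_, fun h' =>
    h.disjoint_innerCone_shadow.le_bot ⟨smul_mem_innerCone ht0 ht1 hz, h'⟩⟩
  · rw [wedge_smul_right]
    exact mul_pos ht0 (lt_of_le_of_ne (h.left_nonneg z hz) fun h' => h1 (h.eq_left hz h'.symm))
  · rw [wedge_smul_left]
    exact mul_pos ht0 (lt_of_le_of_ne (h.right_nonneg z hz) fun h' => h2 (h.eq_right hz h'.symm))

lemma closure_innerCone : closure (innerCone Γ) = closedCone Γ := by
  apply subset_antisymm
  · exact h.isCompact_closedCone.isClosed.closure_subset_iff.2 (innerCone_subset_closedCone Γ)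
  · rintro _ ⟨⟨t, z⟩, ⟨ht, hz⟩, rfl⟩
    have hc : Continuous fun s : ℝ => s • z := by fun_prop
    rw [← closure_Ioo (zero_ne_one (α := ℝ))] at ht
    refine closure_mono ?_ (image_closure_subset_closure_image hc (mem_image_of_mem _ ht))
    rintro _ ⟨s, hs, rfl⟩
    exact smul_mem_innerCone hs.1 hs.2 hz

lemma frontier_innerCone : frontier (innerCone Γ) =
    {w : ℂ | ∃ t ∈ Ico (0 : ℝ) 1, w = (t : ℂ) * z₁} ∪
      {w : ℂ | ∃ t ∈ Ioo (0 : ℝ) 1, w = (t : ℂ) * z₂} ∪ Γ := by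
  simp only [← Complex.real_smul]
  rw [frontier, h.closure_innerCone]
  apply subset_antisymm
  · rintro _ ⟨⟨⟨t, z⟩, ⟨⟨ht0, ht1⟩, hz⟩, rfl⟩, hw⟩
    have ht0 : 0 ≤ t := ht0
    have ht1 : t ≤ 1 := ht1
    rcases ht0.eq_or_lt with rfl | ht0
    · exact .inl (.inl ⟨0, by simp, by simp⟩)
    rcases ht1.eq_or_lt with rfl | ht1
    · exact .inr (by simpa using hz)
    by_cases hz1 : z = z₁
    · exact .inl (.inl ⟨t, ⟨ht0.le, ht1⟩, by rw [hz1]⟩)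
    by_cases hz2 : z = z₂
    · exact .inl (.inr ⟨t, ⟨ht0, ht1⟩, by rw [hz2]⟩)
    exact absurd (h.smul_mem_interior_innerCone ht0 ht1 hz hz1 hz2) hw
  · rw [h.interior_innerCone]
    rintro w ((⟨t, ht, rfl⟩ | ⟨t, ht, rfl⟩) | hw)
    · exact ⟨smul_mem_closedCone ht.1 ht.2.le h.left_mem, fun h' => by simp at h'⟩
    · exact ⟨smul_mem_closedCone ht.1.le ht.2.le h.right_mem, fun h' => by simp at h'⟩
    · refine ⟨⟨(1, w), ⟨by simp, hw⟩, one_smul ℝ w⟩, fun h' => h'.2.2 ⟨1, by simp, by simpa⟩⟩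

end IsRadialArc

lemma wedge_eq_norm_mul_sin (z w : ℂ) :
    wedge z w = ‖z‖ * ‖w‖ * Real.sin (w.arg - z.arg) := by
  unfold wedge
  rw [Real.sin_sub]
  nth_rewrite 1 [← Complex.norm_mul_cos_arg z]
  nth_rewrite 1 [← Complex.norm_mul_sin_arg z]
  nth_rewrite 1 [← Complex.norm_mul_cos_arg w]
  nth_rewrite 1 [← Complex.norm_mul_sin_arg w]
  ring

lemma wedge_pos_of_arg_lt {z w : ℂ} (hz : 0 < z.arg) (hzw : z.arg < w.arg)
    (hw : w.arg < Real.pi) : 0 < wedge z w := by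
  rw [wedge_eq_norm_mul_sin]
  have h1 : z ≠ 0 := by rintro rfl; simp at hz
  have h2 : w ≠ 0 := by rintro rfl; rw [Complex.arg_zero] at hzw; linarith
  have := Real.sin_pos_of_pos_of_lt_pi (x := w.arg - z.arg) (by linarith) (by linarith)
  positivity

lemma im_pos_of_arg {z : ℂ} (h0 : 0 < z.arg) (hpi : z.arg < Real.pi) : 0 < z.im := by
  have hz : z ≠ 0 := by rintro rfl; simp at h0
  rw [← Complex.norm_mul_sin_arg z]
  exact mul_pos (norm_pos_iff.2 hz) (Real.sin_pos_of_pos_of_lt_pi h0 hpi)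

lemma wedge_nonneg_iff {z w : ℂ} (hz : z ≠ 0) (hw : w ≠ 0) :
    0 ≤ wedge z w ↔ 0 ≤ Real.sin (w.arg - z.arg) := by
  rw [wedge_eq_norm_mul_sin]
  exact mul_nonneg_iff_of_pos_left (by positivity)

lemma sectorSet_eq_wedgeSector {z₁ z₂ : ℂ} (h1 : 0 < z₁.arg) (h12 : z₁.arg < z₂.arg)
    (h2 : z₂.arg < Real.pi) : SectorSet z₁ z₂ = wedgeSector z₁ z₂ := by
  ext w
  refine and_congr_right fun hw => ?_
  rw [wedge_nonneg_iff (by rintro rfl; simp at h1) hw,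
    wedge_nonneg_iff hw (by rintro rfl; rw [Complex.arg_zero] at h12; linarith)]
  have hw1 := Complex.neg_pi_lt_arg w
  have hw2 := Complex.arg_le_pi w
  constructor
  · rintro ⟨ha, hb⟩
    exact ⟨Real.sin_nonneg_of_nonneg_of_le_pi (by linarith) (by linarith),
      Real.sin_nonneg_of_nonneg_of_le_pi (by linarith) (by linarith)⟩
  · rintro ⟨ha, hb⟩
    have hb' : w.arg ≤ z₂.arg := by
      by_contra! hlt
      linarith [Real.sin_neg_of_neg_of_neg_pi_lt (x := z₂.arg - w.arg) (by linarith)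
        (by linarith)]
    refine ⟨?_, hb'⟩
    by_contra! hlt
    rcases lt_or_ge (-Real.pi) (w.arg - z₁.arg) with h | h
    · linarith [Real.sin_neg_of_neg_of_neg_pi_lt (x := w.arg - z₁.arg) (by linarith) h]
    · have := Real.sin_neg_of_neg_of_neg_pi_lt (x := z₂.arg - w.arg - 2 * Real.pi)
        (by linarith) (by linarith)
      rw [Real.sin_sub_two_pi] at this
      linarith

namespace IsRadialArc

variable {Γ : Set ℂ} {z₁ z₂ : ℂ} (h : IsRadialArc Γ z₁ z₂)
include h

lemma convexHull_eq_closedCone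
    (hray : ∀ p ∈ convexHull ℝ (Γ ∪ {0}), ∀ s : ℝ, 0 < s → s < 1 → s • p ∉ Γ) :
    convexHull ℝ (Γ ∪ {0}) = closedCone Γ := by
  have h0 : (0 : ℂ) ∈ convexHull ℝ (Γ ∪ {0}) := subset_convexHull ℝ _ (by simp)
  apply subset_antisymm
  · intro w hw
    have hconv : Convex ℝ {w | 0 ≤ wedge z₁ w ∧ 0 ≤ wedge w z₂} := by
      rintro u ⟨hu1, hu2⟩ v ⟨hv1, hv2⟩ a b ha hb -
      constructor
      · rw [wedge_add_right, wedge_smul_right, wedge_smul_right]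
        positivity
      · rw [wedge_add_left, wedge_smul_left, wedge_smul_left]
        positivity
    have hsub : Γ ∪ {0} ⊆ {w | 0 ≤ wedge z₁ w ∧ 0 ≤ wedge w z₂} := by
      rintro z (hz | rfl)
      · exact ⟨h.left_nonneg z hz, h.right_nonneg z hz⟩
      · simp [wedge]
    by_cases hw0 : w = 0
    · exact ⟨(0, z₁), ⟨by simp, h.left_mem⟩, by simp [hw0]⟩
    have hwS := convexHull_min hsub hconv hw
    obtain ⟨t, ht, z, hz, rfl⟩ := h.exists_smul w hw0 hwS.1 hwS.2
    refine smul_mem_closedCone ht.le ?_ hz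
    by_contra! hlt
    exact hray _ hw t⁻¹ (by positivity) (inv_lt_one_of_one_lt₀ hlt) (by
      rwa [inv_smul_smul₀ ht.ne'])
  · rintro _ ⟨⟨t, z⟩, ⟨⟨ht0, ht1⟩, hz⟩, rfl⟩
    exact ((convex_convexHull ℝ _).starConvex h0).smul_mem
      (subset_convexHull ℝ _ (.inl hz)) ht0 ht1

lemma closedCone_diff : closedCone Γ \ (Γ ∪ {0}) = innerCone Γ := by
  apply subset_antisymm
  · rintro _ ⟨⟨⟨t, z⟩, ⟨⟨ht0, ht1⟩, hz⟩, rfl⟩, hw⟩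
    refine smul_mem_innerCone (lt_of_le_of_ne ht0 ?_) (lt_of_le_of_ne ht1 ?_) hz
    · rintro rfl
      exact hw (.inr (zero_smul ℝ z))
    · rintro rfl
      exact hw (.inl (by simpa using hz))
  · intro w hw
    have hmem : w ∈ wedgeSector z₁ z₂ \ Γ := by
      rw [h.wedgeSector_diff_eq]
      exact .inl hw
    refine ⟨innerCone_subset_closedCone Γ hw, ?_⟩
    rintro (hw' | hw')
    · exact hmem.2 hw'
    · exact hmem.1.1 hw'

omit h in
omit h in
lemma innerCone_eq_of_convexHull (h0 : (0 : ℂ) ∉ convexHull ℝ Γ)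
    (hK : convexHull ℝ Γ ⊆ closedCone Γ) :
    innerCone Γ = {w : ℂ | ∃ t ∈ Ioo (0 : ℝ) 1, ∃ z ∈ convexHull ℝ Γ, w = (t : ℂ) * z} := by
  apply subset_antisymm
  · rintro _ ⟨⟨t, z⟩, ⟨ht, hz⟩, rfl⟩
    exact ⟨t, ht, z, subset_convexHull ℝ _ hz, Complex.real_smul⟩
  · rintro _ ⟨t, ht, z, hz, rfl⟩
    obtain ⟨⟨s, z'⟩, ⟨⟨hs0, hs1⟩, hz'⟩, rfl⟩ := hK hz
    have hs : 0 < s := lt_of_le_of_ne hs0 (by rintro rfl; exact h0 (by simpa using hz))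
    rw [← Complex.real_smul, smul_smul]
    exact smul_mem_innerCone (mul_pos ht.1 hs) (mul_lt_one_of_nonneg_of_lt_one_left ht.1.le ht.2
      hs1) hz'

lemma wedge_lt_add (hconv : StrictlyConvexArc Γ) (hK : Convex ℝ (closedCone Γ)) {z : ℂ}
    (hz : z ∈ Γ) (h1 : z ≠ z₁) (h2 : z ≠ z₂) : wedge z₁ z₂ < wedge z z₂ + wedge z₁ z := by
  have hD := h.wedge_pos
  have ha : 0 < wedge z z₂ :=
    lt_of_le_of_ne (h.right_nonneg z hz) fun h' => h2 (h.eq_right hz h'.symm)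
  have hb : 0 < wedge z₁ z :=
    lt_of_le_of_ne (h.left_nonneg z hz) fun h' => h1 (h.eq_left hz h'.symm)
  have hne : z₁ ≠ z₂ := by rintro h'; rw [h', wedge_self] at hD; exact hD.false
  have hsum : 0 < wedge z z₂ + wedge z₁ z := by positivity
  have hmem := hK (subset_closedCone Γ h.left_mem) (subset_closedCone Γ h.right_mem)
    (a := wedge z z₂ / (wedge z z₂ + wedge z₁ z)) (b := wedge z₁ z / (wedge z z₂ + wedge z₁ z))
    (by positivity) (by positivity) (by field_simp)
  have heq : (wedge z z₂ / (wedge z z₂ + wedge z₁ z)) • z₁ +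
      (wedge z₁ z / (wedge z z₂ + wedge z₁ z)) • z₂ =
      (wedge z₁ z₂ / (wedge z z₂ + wedge z₁ z)) • z := by
    rw [div_eq_inv_mul, div_eq_inv_mul, div_eq_inv_mul, mul_smul, mul_smul, mul_smul, ← smul_add,
      ← wedge_smul_eq]
  by_contra! hle
  rcases hle.lt_or_eq with hlt | he
  · rw [heq] at hmem
    exact h.disjoint_outerCone_closedCone.le_bot
      ⟨smul_mem_outerCone ((one_lt_div hsum).2 hlt) hz, hmem⟩
  · rw [← he, div_self hsum.ne', one_smul] at heq
    have hcol : Collinear ℝ {z₁, z, z₂} := by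
      refine Wbtw.collinear (mem_segment_iff_wbtw.1
        ⟨_, _, div_nonneg ha.le hsum.le, div_nonneg hb.le hsum.le, ?_, heq⟩)
      field_simp
    rcases hconv _ h.left_mem _ hz _ h.right_mem hcol with h' | h' | h'
    · exact h1 h'.symm
    · exact hne h'
    · exact h2 h'

/-- Over the interval between the abscissas of its endpoints, a strictly convex radial arc is,
up to its endpoints, the part of the boundary of `closedCone Γ` on which
`(z₁.re - z₂.re) * w.im` is maximal on vertical lines. -/
lemma exists_graph (hconv : StrictlyConvexArc Γ) (hK : Convex ℝ (closedCone Γ))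
    (hint : ∀ z ∈ Γ, z ∉ interior (closedCone Γ)) (hre : z₁.re ≠ z₂.re) :
    ∃ g : ℝ → ℝ,
      Γ ∩ {w : ℂ | w.re ∈ uIcc z₁.re z₂.re} =
        {w : ℂ | w.re ∈ uIcc z₁.re z₂.re ∧ w.im = g w.re} ∪ {z₁, z₂} ∧
      ∀ x ∈ uIcc z₁.re z₂.re, ∀ y ∈ uIcc z₁.re z₂.re, ∀ a b : ℝ, 0 ≤ a → 0 ≤ b → a + b = 1 →
        (z₁.re - z₂.re) * (a * g x + b * g y) ≤ (z₁.re - z₂.re) * g (a * x + b * y) := by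
  have hD := h.wedge_pos
  have hσ : z₁.re - z₂.re ≠ 0 := sub_ne_zero.2 hre
  have hheight : ∀ u v : ℂ, u.re = v.re → (wedge u z₂ + wedge z₁ u) - (wedge v z₂ + wedge z₁ v) =
      (z₁.re - z₂.re) * u.im - (z₁.re - z₂.re) * v.im := fun u v huv => by
    unfold wedge
    rw [huv]
    ring
  have hchord : ∀ x ∈ uIcc z₁.re z₂.re, ∃ a b : ℝ, 0 ≤ a ∧ 0 ≤ b ∧ a + b = 1 ∧
      (a • z₁ + b • z₂).re = x := fun x hx => by
    rw [← segment_eq_uIcc] at hx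
    obtain ⟨a, b, ha, hb, hab, rfl⟩ := hx
    exact ⟨a, b, ha, hb, hab, by simp⟩
  have hchord_wedge : ∀ a b : ℝ, a + b = 1 →
      wedge (a • z₁ + b • z₂) z₂ + wedge z₁ (a • z₁ + b • z₂) = wedge z₁ z₂ := fun a b hab => by
    rw [wedge_add_left, wedge_add_right]
    simp only [wedge_smul_left, wedge_smul_right, wedge_self]
    linear_combination wedge z₁ z₂ * hab
  have hmax : ∀ x ∈ uIcc z₁.re z₂.re, ∃ p ∈ Γ, p.re = x ∧
      ∀ w ∈ closedCone Γ, w.re = x → (z₁.re - z₂.re) * w.im ≤ (z₁.re - z₂.re) * p.im := by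
    intro x hx
    obtain ⟨a, b, ha, hb, hab, hc⟩ := hchord x hx
    have hcK := hK (subset_closedCone Γ h.left_mem) (subset_closedCone Γ h.right_mem) ha hb hab
    have hcpt : IsCompact (closedCone Γ ∩ {w | w.re = x}) :=
      h.isCompact_closedCone.inter_right (isClosed_eq Complex.continuous_re continuous_const)
    obtain ⟨p, ⟨hpK, hpx⟩, hp⟩ := hcpt.exists_isMaxOn ⟨_, hcK, hc⟩
      (f := fun w => (z₁.re - z₂.re) * w.im) (by fun_prop)
    have hpx : p.re = x := hpx
    have hpmax : ∀ w ∈ closedCone Γ, w.re = x →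
        (z₁.re - z₂.re) * w.im ≤ (z₁.re - z₂.re) * p.im := fun w hw hwx => hp ⟨hw, hwx⟩
    refine ⟨p, ?_, hpx, hpmax⟩
    have hpD : wedge z₁ z₂ ≤ wedge p z₂ + wedge z₁ p := by
      linarith [hheight p _ (hpx.trans hc.symm), hpmax _ hcK hc, hchord_wedge a b hab]
    obtain ⟨⟨t, z⟩, ⟨⟨ht0, ht1⟩, hz⟩, rfl⟩ := hpK
    simp only at ht0 ht1 hz hpx hpmax hpD ⊢
    rcases ht1.eq_or_lt with rfl | ht1
    · simpa using hz
    exfalso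
    rw [wedge_smul_left, wedge_smul_right, ← mul_add] at hpD
    have ht0 : 0 < t := lt_of_le_of_ne ht0 (by rintro rfl; linarith)
    have hzi : t • z ∈ interior (innerCone Γ) := by
      refine h.smul_mem_interior_innerCone ht0 ht1 hz ?_ ?_ <;> rintro rfl <;>
        rw [wedge_self] at hpD <;> nlinarith
    have hcont : ContinuousAt (fun s : ℝ => t • z + (s * (z₁.re - z₂.re)) • Complex.I) 0 := by
      fun_prop
    have hev : ∀ᶠ s in 𝓝 (0 : ℝ), t • z + (s * (z₁.re - z₂.re)) • Complex.I ∈ innerCone Γ :=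
      hcont.eventually (by simpa using mem_interior_iff_mem_nhds.1 hzi)
    obtain ⟨s, hs, hs0⟩ :=
      ((hev.filter_mono nhdsWithin_le_nhds).and (self_mem_nhdsWithin (s := Ioi (0 : ℝ)))).exists
    have hs0 : 0 < s := hs0
    have hle := hpmax _ (innerCone_subset_closedCone Γ hs) (by simpa using hpx)
    have him : (t • z + (s * (z₁.re - z₂.re)) • Complex.I).im =
        (t • z).im + s * (z₁.re - z₂.re) := by simp
    rw [him] at hle
    have : 0 < s * (z₁.re - z₂.re) ^ 2 := by positivity
    nlinarith
  choose! p hpΓ hpre hpmax using hmax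
  refine ⟨fun x => (p x).im, ?_, ?_⟩
  · apply subset_antisymm
    · rintro z ⟨hz, hzI⟩
      by_cases h1 : z = z₁
      · exact .inr (.inl h1)
      by_cases h2 : z = z₂
      · exact .inr (.inr h2)
      refine .inl ⟨hzI, ?_⟩
      by_contra hne
      have hzI : z.re ∈ uIcc z₁.re z₂.re := hzI
      obtain ⟨a, b, ha, hb, hab, hc⟩ := hchord _ hzI
      have hcK := hK (subset_closedCone Γ h.left_mem) (subset_closedCone Γ h.right_mem) ha hb hab
      have hcD := hchord_wedge a b hab
      have hzD := h.wedge_lt_add hconv hK hz h1 h2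
      have hcz : (z₁.re - z₂.re) * (a • z₁ + b • z₂).im < (z₁.re - z₂.re) * z.im := by
        linarith [hheight z _ hc.symm]
      have hzp : (z₁.re - z₂.re) * z.im < (z₁.re - z₂.re) * (p z.re).im :=
        lt_of_le_of_ne (hpmax _ hzI z (subset_closedCone Γ hz) rfl) fun h' => hne (mul_left_cancel₀ hσ h')
      have hcΓ : a • z₁ + b • z₂ ∉ Γ := by
        intro hcΓ
        have hcol : ∀ w : ℂ, w.re = z.re → ∃ c : ℝ, w = z.re + c • Complex.I := fun w hw =>
          ⟨w.im, by rw [← hw, Complex.real_smul, Complex.re_add_im]⟩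
        rcases hconv _ hcΓ _ hz _ (hpΓ _ hzI) (collinear_of_eq_add_smul (hcol _ hc) (hcol _ rfl)
          (hcol _ (hpre _ hzI))) with h' | h' | h'
        · rw [h'] at hcz; exact hcz.false
        · rw [h'] at hcz; exact (hcz.trans hzp).false
        · rw [← h'] at hzp; exact hzp.false
      have ha : 0 < a := lt_of_le_of_ne ha (by
        rintro rfl
        rw [zero_add] at hab
        exact hcΓ (by simpa [hab] using h.right_mem))
      have hb : 0 < b := lt_of_le_of_ne hb (by
        rintro rfl
        rw [add_zero] at hab
        exact hcΓ (by simpa [hab] using h.left_mem))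
      have hci : a • z₁ + b • z₂ ∈ interior (closedCone Γ) := by
        have w1 : 0 < wedge z₁ (a • z₁ + b • z₂) := by
          rw [wedge_add_right, wedge_smul_right, wedge_smul_right, wedge_self]
          positivity
        have w2 : 0 < wedge (a • z₁ + b • z₂) z₂ := by
          rw [wedge_add_left, wedge_smul_left, wedge_smul_left, wedge_self]
          positivity
        obtain ⟨⟨t, z'⟩, ⟨⟨ht0, ht1⟩, hz'⟩, hcz'⟩ := hcK
        simp only at ht0 ht1 hz' hcz'
        rw [← hcz'] at w1 w2 hcΓ ⊢
        rw [wedge_smul_right] at w1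
        rw [wedge_smul_left] at w2
        refine interior_mono (innerCone_subset_closedCone Γ)
          (h.smul_mem_interior_innerCone (lt_of_le_of_ne ht0 ?_) (lt_of_le_of_ne ht1 ?_) hz' ?_ ?_)
        · rintro rfl; simp at w1
        · rintro rfl; exact hcΓ (by simpa using hz')
        · rintro rfl; simp at w1
        · rintro rfl; simp at w2
      refine hint z hz (hK.openSegment_interior_self_subset_interior hci
        (subset_closedCone Γ (hpΓ _ hzI)) ?_)
      set c := a • z₁ + b • z₂
      set σ := z₁.re - z₂.re
      have hd : 0 < σ * (p z.re).im - σ * c.im := by linarith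
      refine ⟨(σ * (p z.re).im - σ * z.im) / (σ * (p z.re).im - σ * c.im),
        (σ * z.im - σ * c.im) / (σ * (p z.re).im - σ * c.im), div_pos (by linarith) hd,
        div_pos (by linarith) hd,
        by rw [← add_div, div_eq_one_iff_eq hd.ne']; ring, ?_⟩
      have hd' : (p z.re).im - c.im ≠ 0 := fun h' => by
        rw [← mul_sub, h', mul_zero] at hd; exact hd.false
      simp only [← mul_sub, mul_div_mul_left _ _ hσ]
      apply Complex.ext
      · simp only [Complex.real_smul, Complex.add_re, Complex.re_ofReal_mul, hc, hpre _ hzI]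
        field_simp
        ring
      · simp only [Complex.real_smul, Complex.add_im, Complex.im_ofReal_mul]
        field_simp
        ring
    · rintro w (⟨hw, hwp⟩ | rfl | rfl)
      · refine ⟨?_, hw⟩
        rw [show w = p w.re from Complex.ext (hpre _ hw).symm hwp]
        exact hpΓ _ hw
      · exact ⟨h.left_mem, left_mem_uIcc⟩
      · exact ⟨h.right_mem, right_mem_uIcc⟩
  · intro x hx y hy a b ha hb hab
    have hxy : a * x + b * y ∈ uIcc z₁.re z₂.re := (convex_uIcc _ _) hx hy ha hb hab
    have := hpmax _ hxy _ (hK (subset_closedCone Γ (hpΓ x hx)) (subset_closedCone Γ (hpΓ y hy)) ha hb hab)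
      (by simp [hpre x hx, hpre y hy])
    simpa using this

lemma im_pos (h1 : 0 < z₁.im) (h2 : 0 < z₂.im) {z : ℂ} (hz : z ∈ Γ) : 0 < z.im := by
  have hD := h.wedge_pos
  have ha := h.right_nonneg z hz
  have hb := h.left_nonneg z hz
  have heq := congrArg Complex.im (wedge_smul_eq z₁ z₂ z)
  simp only [Complex.real_smul, Complex.add_im, Complex.im_ofReal_mul] at heq
  by_contra! hle
  have ha0 : wedge z z₂ = 0 := by nlinarith [mul_nonneg hb h2.le]
  have hb0 : wedge z₁ z = 0 := by nlinarith [mul_nonneg ha h1.le]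
  rw [h.eq_left hz hb0] at hle
  exact absurd h1 (not_lt.2 hle)

end IsRadialArc

/-- Proposition 7 of the paper. -/
theorem stmt3 (Φ : ℂ → ℂ) (hΦ : Differentiable ℂ Φ) (r : ℝ) (hr : 0 < r)
    (γ : ℝ → ℂ) (hγc : ContinuousOn γ (Icc 0 1)) (hγi : InjOn γ (Icc 0 1))
    (Γ : Set ℂ) (hΓ : Γ = γ '' Icc 0 1)
    (hconvex : ∀ w₁ ∈ Γ, ∀ w₂ ∈ Γ, ∀ u ∈ segment ℝ w₁ w₂ ∩ Γ, ∀ v ∈ segment ℝ w₁ w₂ ∩ Γ,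
      ∀ w ∈ segment ℝ w₁ w₂ ∩ Γ, u = v ∨ u = w ∨ v = w)
    (z₁ z₂ : ℂ) (hz₁ : z₁ = γ 0) (hz₂ : z₂ = γ 1)
    (harg₁ : 0 < z₁.arg) (harg₁₂ : z₁.arg < z₂.arg) (harg₂ : z₂.arg < Real.pi)
    (hre : z₁.re ≠ z₂.re)
    (hlev : ∀ z ∈ Γ, ‖Φ z‖ = r)
    (h0 : (0 : ℂ) ∉ convexHull ℝ Γ)
    (hΩ : OmegaSet Γ ⊆ {z : ℂ | ‖Φ z‖ < r}) :
    -- (i) `S(0,z₁,z₂) \ Γ` has exactly two connected components, of which `Ω` is the bounded one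
    (∃ U : Set ℂ,
      (∀ w ∈ SectorSet z₁ z₂ \ Γ,
        connectedComponentIn (SectorSet z₁ z₂ \ Γ) w = OmegaSet Γ ∨
        connectedComponentIn (SectorSet z₁ z₂ \ Γ) w = U) ∧
      U ≠ OmegaSet Γ ∧
      (∃ w ∈ SectorSet z₁ z₂ \ Γ, connectedComponentIn (SectorSet z₁ z₂ \ Γ) w = OmegaSet Γ) ∧
      (∃ w ∈ SectorSet z₁ z₂ \ Γ, connectedComponentIn (SectorSet z₁ z₂ \ Γ) w = U) ∧
      Bornology.IsBounded (OmegaSet Γ) ∧ ¬ Bornology.IsBounded U) ∧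
    -- (ii) descriptions of `Ω`
    OmegaSet Γ = {w : ℂ | ∃ t ∈ Ioo (0:ℝ) 1, ∃ z ∈ Γ, w = (t : ℂ) * z} ∧
    OmegaSet Γ = {w : ℂ | ∃ t ∈ Ioo (0:ℝ) 1, ∃ z ∈ convexHull ℝ Γ, w = (t : ℂ) * z} ∧
    -- (iii) the boundary of `Ω`
    frontier (OmegaSet Γ) =
      {w : ℂ | ∃ t ∈ Ico (0:ℝ) 1, w = (t : ℂ) * z₁} ∪
      {w : ℂ | ∃ t ∈ Ioo (0:ℝ) 1, w = (t : ℂ) * z₂} ∪ Γ ∧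
    -- (iv) `Γ` over the interval `I` is a graph of a convex/concave function
    (∃ h : ℝ → ℝ,
      Γ ∩ {w : ℂ | w.re ∈ uIcc z₁.re z₂.re ∧ 0 < w.im} =
        {w : ℂ | w.re ∈ uIcc z₁.re z₂.re ∧ w.im = h w.re} ∪ {z₁, z₂} ∧
      (z₁.re < z₂.re → ConvexOn ℝ (uIcc z₁.re z₂.re) h) ∧
      (z₂.re < z₁.re → ConcaveOn ℝ (uIcc z₁.re z₂.re) h)) := by
  subst hΓ hz₁ hz₂
  have hsc := strictlyConvexArc_of_segment hconvex
  have h0Γ : (0 : ℂ) ∉ γ '' Icc 0 1 := fun h => h0 (subset_convexHull ℝ _ h)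
  have hΓK : γ '' Icc 0 1 ⊆ convexHull ℝ (γ '' Icc 0 1 ∪ {0}) :=
    subset_union_left.trans (subset_convexHull ℝ _)
  have hK0 : (0 : ℂ) ∈ convexHull ℝ (γ '' Icc 0 1 ∪ {0}) := subset_convexHull ℝ _ (by simp)
  have hpos := wedge_pos_of_arg_lt harg₁ harg₁₂ harg₂
  have hΩne : (OmegaSet (γ '' Icc 0 1)).Nonempty := by
    have hm₁ : γ 0 ∈ γ '' Icc 0 1 := ⟨0, by simp, rfl⟩
    have hm₂ : γ 1 ∈ γ '' Icc 0 1 := ⟨1, by simp, rfl⟩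
    have hne : γ 0 ≠ γ 1 := fun h => hre (h ▸ rfl)
    have hmid : midpoint ℝ (γ 0) (γ 1) ∈ convexHull ℝ (γ '' Icc 0 1) :=
      (convex_convexHull ℝ _).midpoint_mem (subset_convexHull ℝ _ hm₁)
        (subset_convexHull ℝ _ hm₂)
    refine ⟨_, convexHull_mono subset_union_left hmid, ?_⟩
    rintro (h | h)
    · rcases hsc _ hm₁ _ h _ hm₂ (wbtw_midpoint ℝ _ _).collinear with h' | h' | h'
      · exact hne ((left_eq_midpoint_iff (R := ℝ)).1 h')
      · exact hne h'
      · exact hne ((midpoint_eq_right_iff (R := ℝ)).1 h')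
    · exact h0 (mem_singleton_iff.1 h ▸ hmid)
  have hint : ∀ z ∈ γ '' Icc 0 1, z ∉ interior (convexHull ℝ (γ '' Icc 0 1 ∪ {0})) :=
    fun z hz => notMem_interior_of_norm_lt hΦ hlev h0Γ (fun w hw => hΩ hw) hΩne hz
  have hray : ∀ p ∈ convexHull ℝ (γ '' Icc 0 1 ∪ {0}), ∀ s : ℝ, 0 < s → s < 1 →
      s • p ∉ γ '' Icc 0 1 := fun p hp s hs0 hs1 =>
    smul_notMem_of_notMem_interior (convex_convexHull ℝ _) hΓK hK0 h0Γ hsc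
      (fun q hq => frequently_mem_image_of_injOn hγc hγi hq) hint hp hs0 hs1
  have h := isRadialArc_of_path hγc hγi hpos h0 hΓK hray
  have hKeq := h.convexHull_eq_closedCone hray
  have hΩeq : OmegaSet (γ '' Icc 0 1) = innerCone (γ '' Icc 0 1) := by
    rw [OmegaSet, hKeq, h.closedCone_diff]
  rw [sectorSet_eq_wedgeSector harg₁ harg₁₂ harg₂, hΩeq]
  refine ⟨h.exists_components, ?_, ?_, h.frontier_innerCone, ?_⟩
  · ext w
    constructor
    · rintro ⟨⟨t, z⟩, ⟨ht, hz⟩, rfl⟩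
      exact ⟨t, ht, z, hz, Complex.real_smul⟩
    · rintro ⟨t, ht, z, hz, rfl⟩
      exact ⟨(t, z), ⟨ht, hz⟩, Complex.real_smul⟩
  · exact IsRadialArc.innerCone_eq_of_convexHull h0
      (hKeq ▸ convexHull_mono subset_union_left)
  · obtain ⟨g, hg, hg'⟩ := h.exists_graph hsc (hKeq ▸ convex_convexHull ℝ _) (hKeq ▸ hint) hre
    have him₁ : 0 < (γ 0).im := im_pos_of_arg harg₁ (harg₁₂.trans harg₂)
    have him₂ : 0 < (γ 1).im := im_pos_of_arg (harg₁.trans harg₁₂) harg₂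
    refine ⟨g, ?_, fun hlt => ⟨convex_uIcc _ _, ?_⟩, fun hlt => ⟨convex_uIcc _ _, ?_⟩⟩
    · rw [← hg]
      ext w
      exact ⟨fun hw => ⟨hw.1, hw.2.1⟩, fun hw => ⟨hw.1, hw.2, h.im_pos him₁ him₂ hw.1⟩⟩
    · intro x hx y hy a b ha hb hab
      exact (mul_le_mul_left_of_neg (sub_neg.2 hlt)).1 (hg' x hx y hy a b ha hb hab)
    · intro x hx y hy a b ha hb hab
      exact le_of_mul_le_mul_left (hg' x hx y hy a b ha hb hab) (sub_pos.2 hlt)
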